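/- arXiv:2506.04127 — 3 statements merged into one kernel-verified Lean document; each statement's English description precedes it below -/
import Mathlib

section
/- Consider the CLTSP with zero-processing times and only deadlines (τ(a) = 0 and r(a) = 0 for all a ∈ A). If the instance admits a feasible solution, then there exists an optimal solution (one minimizing the makespan among feasible solutions) that is order-preserving, i.e., for any two clients a, a' both in L or both in R with |s(a)| < |s(a')| one has t(a) < t(a'). -/
open scoped BigOperators

/-- An instance of the collaborative line TSP/TRP: a finite set of `n` clients,
a client speed `v > 0`, and for each client a start position `s`, release date
`r ≥ 0`, deadline `d ∈ [0, ∞]` and processing time `tau ≥ 0`. -/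
structure CInstance (n : ℕ) where
  v : ℝ
  s : Fin n → ℝ
  r : Fin n → ℝ
  d : Fin n → EReal
  tau : Fin n → ℝ
  hv : 0 < v
  hr : ∀ a, 0 ≤ r a
  hd : ∀ a, (0 : EReal) ≤ d a
  htau : ∀ a, 0 ≤ tau a

/-- A solution: a serving order `σ` (the `i`-th rendezvous, `i = 0, …, n-1`
in zero-based counting, serves client `σ i`), a rendezvous time `t a` and a
rendezvous position `x a` for every client `a`, and a final time `tEnd` at
which the server is back at the origin. -/
structure CSolution (n : ℕ) where
  σ : Equiv.Perm (Fin n)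
  t : Fin n → ℝ
  x : Fin n → ℝ
  tEnd : ℝ

namespace CLTSP

variable {n : ℕ}

/-- Position `x_i` of the `i`-th server stop, `i = 0, …, n+1`; `x_0 = x_{n+1} = 0`. -/
def pos (sol : CSolution n) (i : ℕ) : ℝ :=
  if h : 1 ≤ i ∧ i ≤ n then sol.x (sol.σ ⟨i - 1, by omega⟩) else 0

/-- Time `t_i` of the `i`-th server stop, `i = 0, …, n+1`; `t_0 = 0`, `t_{n+1} = tEnd`. -/
def time (sol : CSolution n) (i : ℕ) : ℝ :=
  if h : 1 ≤ i ∧ i ≤ n then sol.t (sol.σ ⟨i - 1, by omega⟩)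
  else if i = 0 then 0 else sol.tEnd

/-- Completion time `c_i` of the `i`-th rendezvous: `c_0 = 0`,
`c_i = t_i + τ(σ_i)` for `1 ≤ i ≤ n`, and `c_{n+1} = tEnd`. -/
def comp (I : CInstance n) (sol : CSolution n) (i : ℕ) : ℝ :=
  if h : 1 ≤ i ∧ i ≤ n then
    sol.t (sol.σ ⟨i - 1, by omega⟩) + I.tau (sol.σ ⟨i - 1, by omega⟩)
  else if i = 0 then 0 else sol.tEnd

/-- Feasibility: every rendezvous (including the final return to the origin) is
reachable by the server, every rendezvous is reachable by the corresponding
client, and every client is served within its time window. -/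
def Feasible (I : CInstance n) (sol : CSolution n) : Prop :=
  (∀ i : ℕ, 1 ≤ i → i ≤ n + 1 →
      comp I sol (i - 1) + |pos sol i - pos sol (i - 1)| ≤ time sol i) ∧
  (∀ a, I.r a + |sol.x a - I.s a| / I.v ≤ sol.t a) ∧
  (∀ a, I.r a ≤ sol.t a ∧ (sol.t a : EReal) ≤ I.d a)

/-- The makespan `C_max = c_{n+1}`. -/
def makespan (sol : CSolution n) : ℝ := sol.tEnd

/-- The sum of completion times `C_sum = ∑_{i=1}^n c_i = ∑_a (t a + τ a)`. -/
def csum (I : CInstance n) (sol : CSolution n) : ℝ :=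
  ∑ a : Fin n, (sol.t a + I.tau a)

/-- An optimal CLTSP solution: feasible with minimum makespan. -/
def OptimalTSP (I : CInstance n) (sol : CSolution n) : Prop :=
  Feasible I sol ∧ ∀ sol' : CSolution n, Feasible I sol' → makespan sol ≤ makespan sol'

/-- An optimal CLTRP solution: feasible with minimum sum of completion times. -/
def OptimalTRP (I : CInstance n) (sol : CSolution n) : Prop :=
  Feasible I sol ∧ ∀ sol' : CSolution n, Feasible I sol' → csum I sol ≤ csum I sol'

/-- Order-preserving: for clients `a, a'` both in `L = {a : s a ≤ 0}` or both in
`R = {a : 0 < s a}` with `|s a| < |s a'|` we have `t a < t a'`. -/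
def OrderPreserving (I : CInstance n) (sol : CSolution n) : Prop :=
  ∀ a a' : Fin n,
    ((I.s a ≤ 0 ∧ I.s a' ≤ 0) ∨ (0 < I.s a ∧ 0 < I.s a')) →
    |I.s a| < |I.s a'| → sol.t a < sol.t a'

/-- Wait-free server: `t_i = c_{i-1} + |x_i - x_{i-1}|` for all `1 ≤ i ≤ n+1`. -/
def WaitFree (I : CInstance n) (sol : CSolution n) : Prop :=
  ∀ i : ℕ, 1 ≤ i → i ≤ n + 1 →
    time sol i = comp I sol (i - 1) + |pos sol i - pos sol (i - 1)|

/-- Colliding clients: each client `a = σ_i` satisfies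
`t a = max (r a + |s a - x a| / v) (c_{i-1})`. -/
def Colliding (I : CInstance n) (sol : CSolution n) : Prop :=
  ∀ a : Fin n,
    sol.t a = max (I.r a + |I.s a - sol.x a| / I.v)
      (comp I sol ((sol.σ.symm a : ℕ)))

end CLTSP

namespace CLTSP

variable {n : ℕ}

lemma time_zero (sol : CSolution n) : time sol 0 = 0 := by simp [time]

lemma pos_zero (sol : CSolution n) : pos sol 0 = 0 := by simp [pos]

lemma time_last (sol : CSolution n) : time sol (n + 1) = sol.tEnd := by simp [time]

lemma pos_last (sol : CSolution n) : pos sol (n + 1) = 0 := by simp [pos]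

lemma time_succ (sol : CSolution n) (i : Fin n) :
    time sol (i + 1) = sol.t (sol.σ i) := by
  simp [time, Nat.succ_le_of_lt i.2]

lemma pos_succ (sol : CSolution n) (i : Fin n) :
    pos sol (i + 1) = sol.x (sol.σ i) := by
  simp [pos, Nat.succ_le_of_lt i.2]

lemma comp_eq_time {I : CInstance n} (htau : ∀ a, I.tau a = 0) (sol : CSolution n) (i : ℕ) :
    comp I sol i = time sol i := by
  simp [comp, time, htau]

/-- Between any two stops, the server covers a distance at most the elapsed time. -/
lemma Feasible.abs_pos_sub_le {I : CInstance n} (htau : ∀ a, I.tau a = 0) {sol : CSolution n}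
    (h : Feasible I sol) {i j : ℕ} (hij : i ≤ j) (hj : j ≤ n + 1) :
    |pos sol j - pos sol i| ≤ time sol j - time sol i := by
  induction j, hij using Nat.le_induction with
  | base => simp
  | succ k hk ih =>
    have h1 := h.1 (k + 1) (by omega) hj
    rw [comp_eq_time htau, Nat.add_sub_cancel] at h1
    have h2 := ih (by omega)
    have h3 := abs_sub_le (pos sol (k + 1)) (pos sol k) (pos sol i)
    linarith

lemma Feasible.abs_x_le {I : CInstance n} (htau : ∀ a, I.tau a = 0) {sol : CSolution n}
    (h : Feasible I sol) (a : Fin n) : |sol.x a| ≤ sol.t a := by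
  have := h.abs_pos_sub_le htau (Nat.zero_le ((sol.σ.symm a : ℕ) + 1)) (by omega)
  simpa [time_zero, pos_zero, time_succ, pos_succ] using this

lemma Feasible.t_nonneg {I : CInstance n} {sol : CSolution n}
    (h : Feasible I sol) (a : Fin n) : 0 ≤ sol.t a :=
  (I.hr a).trans (h.2.2 a).1

lemma Feasible.t_le_tEnd {I : CInstance n} (htau : ∀ a, I.tau a = 0) {sol : CSolution n}
    (h : Feasible I sol) (a : Fin n) : sol.t a ≤ sol.tEnd := by
  have := h.abs_pos_sub_le htau (i := (sol.σ.symm a : ℕ) + 1) (j := n + 1) (by omega) le_rfl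
  rw [time_last, time_succ, Equiv.apply_symm_apply] at this
  linarith [(abs_nonneg _).trans this]

lemma Feasible.tEnd_nonneg {I : CInstance n} (htau : ∀ a, I.tau a = 0) {sol : CSolution n}
    (h : Feasible I sol) : 0 ≤ sol.tEnd := by
  have := h.abs_pos_sub_le htau (Nat.zero_le (n + 1)) le_rfl
  rw [time_last, time_zero] at this
  linarith [(abs_nonneg _).trans this]

/-- The stops of a feasible solution are interpolated by a server trajectory of speed at most 1. -/
lemma Feasible.exists_trajectory {I : CInstance n} (htau : ∀ a, I.tau a = 0)
    {sol : CSolution n} (h : Feasible I sol) :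
    ∃ p : ℝ → ℝ, LipschitzWith 1 p ∧ p 0 = 0 ∧ p sol.tEnd = 0 ∧
      ∀ a, p (sol.t a) = sol.x a := by
  have hlip : ∀ i ≤ n + 1, ∀ j ≤ n + 1,
      |pos sol i - pos sol j| ≤ |time sol i - time sol j| := by
    intro i hi j hj
    rcases le_total i j with hij | hij
    · rw [abs_sub_comm (pos sol i), abs_sub_comm (time sol i)]
      exact (h.abs_pos_sub_le htau hij hj).trans (le_abs_self _)
    · exact (h.abs_pos_sub_le htau hij hi).trans (le_abs_self _)
  have hf : ∃ f : ℝ → ℝ, ∀ i ≤ n + 1, f (time sol i) = pos sol i := by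
    classical
    refine ⟨fun τ => if hτ : ∃ i ≤ n + 1, time sol i = τ then pos sol hτ.choose else 0, ?_⟩
    intro i hi
    have hex : ∃ j ≤ n + 1, time sol j = time sol i := ⟨i, hi, rfl⟩
    simp only [dif_pos hex]
    have := hlip _ hex.choose_spec.1 i hi
    rw [hex.choose_spec.2, sub_self, abs_zero] at this
    exact sub_eq_zero.mp (abs_eq_zero.mp (this.antisymm (abs_nonneg _)))
  obtain ⟨f, hf⟩ := hf
  have hfl : LipschitzOnWith 1 f {τ | ∃ i ≤ n + 1, time sol i = τ} := by
    refine LipschitzOnWith.of_dist_le_mul ?_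
    rintro _ ⟨i, hi, rfl⟩ _ ⟨j, hj, rfl⟩
    simpa [hf i hi, hf j hj, Real.dist_eq] using hlip i hi j hj
  obtain ⟨p, hp, hfp⟩ := hfl.extend_real
  have hpt : ∀ i ≤ n + 1, p (time sol i) = pos sol i := fun i hi =>
    (hfp ⟨i, hi, rfl⟩).symm.trans (hf i hi)
  refine ⟨p, hp, ?_, ?_, fun a => ?_⟩
  · simpa [time_zero, pos_zero] using hpt 0 (by omega)
  · simpa [time_last, pos_last] using hpt (n + 1) le_rfl
  · simpa [time_succ, pos_succ] using hpt ((sol.σ.symm a : ℕ) + 1) (by omega)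

/-- Times at which a client starting at `s` with speed `v` can be at the position of a server
following the trajectory `p`. -/
def meetingTimes (v : ℝ) (p : ℝ → ℝ) (s : ℝ) : Set ℝ :=
  {τ | 0 ≤ τ ∧ |p τ - s| ≤ v * τ}

lemma exists_isLeast_meetingTimes {v : ℝ} {p : ℝ → ℝ} (hp : Continuous p) {s : ℝ}
    (hne : (meetingTimes v p s).Nonempty) : ∃ τ, IsLeast (meetingTimes v p s) τ := by
  have hcl : IsClosed (meetingTimes v p s) :=
    (isClosed_le continuous_const continuous_id).inter
      (isClosed_le (hp.sub continuous_const).abs (continuous_const.mul continuous_id))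
  exact ⟨_, hcl.isLeast_csInf hne ⟨0, fun _ h => h.1⟩⟩

lemma exists_lt_mem_meetingTimes_of_nonneg {v : ℝ} {p : ℝ → ℝ} (hv : 0 < v) (hp : Continuous p)
    (hp0 : p 0 = 0) {s s' τ' : ℝ} (hs : 0 ≤ s) (hss : s < s') (hτ : τ' ∈ meetingTimes v p s') :
    ∃ τ ∈ meetingTimes v p s, τ < τ' := by
  have h1 := (abs_le.mp hτ.2).1
  obtain ⟨τ, ⟨h0, hle⟩, hz⟩ := intermediate_value_Icc (f := fun τ => v * τ + p τ - s) hτ.1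
    (by fun_prop) (show (0 : ℝ) ∈ _ from ⟨by simp [hp0, hs], by linarith⟩)
  have hz' : v * τ + p τ - s = 0 := hz
  have hvτ : 0 ≤ v * τ := mul_nonneg hv.le h0
  refine ⟨τ, ⟨h0, abs_le.mpr ⟨by linarith, by linarith⟩⟩, hle.lt_of_ne ?_⟩
  rintro rfl
  linarith

lemma meetingTimes_neg (v : ℝ) (p : ℝ → ℝ) (s : ℝ) :
    meetingTimes v (fun τ => -p τ) (-s) = meetingTimes v p s := by
  ext τ
  simp only [meetingTimes, Set.mem_ofPred_eq]
  rw [← abs_neg, show -(-p τ - -s) = p τ - s by ring]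

/-- Before meeting a client, the server can meet any client on the same side starting strictly
closer to the origin. -/
lemma exists_lt_mem_meetingTimes {v : ℝ} {p : ℝ → ℝ} (hv : 0 < v) (hp : Continuous p)
    (hp0 : p 0 = 0) {s s' τ' : ℝ} (hside : (s ≤ 0 ∧ s' ≤ 0) ∨ (0 < s ∧ 0 < s'))
    (hss : |s| < |s'|) (hτ : τ' ∈ meetingTimes v p s') :
    ∃ τ ∈ meetingTimes v p s, τ < τ' := by
  rcases hside with ⟨hs, hs'⟩ | ⟨hs, hs'⟩
  · rw [abs_of_nonpos hs, abs_of_nonpos hs'] at hss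
    rw [← meetingTimes_neg] at hτ ⊢
    exact exists_lt_mem_meetingTimes_of_nonneg hv hp.neg (by simp [hp0]) (by linarith) hss hτ
  · rw [abs_of_pos hs, abs_of_pos hs'] at hss
    exact exists_lt_mem_meetingTimes_of_nonneg hv hp hp0 hs.le hss hτ

/-- The solution in which the server follows `p` until time `e` and serves each client `a` at
time `t a`. -/
noncomputable def ofTrajectory (p : ℝ → ℝ) (t : Fin n → ℝ) (e : ℝ) : CSolution n where
  σ := Tuple.sort t
  t := t
  x a := p (t a)
  tEnd := e

lemma pos_ofTrajectory {p : ℝ → ℝ} (hp0 : p 0 = 0) (t : Fin n → ℝ) {e : ℝ} (hpe : p e = 0)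
    (i : ℕ) : pos (ofTrajectory p t e) i = p (time (ofTrajectory p t e) i) := by
  unfold pos time
  split_ifs <;> simp [ofTrajectory, hp0, hpe]

lemma time_ofTrajectory_le (p : ℝ → ℝ) {t : Fin n → ℝ} {e : ℝ} (ht : ∀ a, 0 ≤ t a)
    (hte : ∀ a, t a ≤ e) (he : 0 ≤ e) (i : ℕ) :
    time (ofTrajectory p t e) i ≤ time (ofTrajectory p t e) (i + 1) := by
  unfold time
  split_ifs
  all_goals first
    | contradiction
    | omega
    | exact Tuple.monotone_sort t
        (show (⟨i - 1, _⟩ : Fin n) ≤ ⟨i + 1 - 1, _⟩ from Fin.mk_le_mk.mpr (by omega))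
    | exact hte _
    | exact ht _
    | exact he
    | exact le_rfl

lemma feasible_ofTrajectory {I : CInstance n} (htau : ∀ a, I.tau a = 0)
    (hrel : ∀ a, I.r a = 0) {p : ℝ → ℝ} (hp : LipschitzWith 1 p) (hp0 : p 0 = 0)
    {t : Fin n → ℝ} {e : ℝ} (hpe : p e = 0) (hmeet : ∀ a, t a ∈ meetingTimes I.v p (I.s a))
    (hd : ∀ a, (t a : EReal) ≤ I.d a) (hte : ∀ a, t a ≤ e) (he : 0 ≤ e) :
    Feasible I (ofTrajectory p t e) := by
  refine ⟨fun i hi _ => ?_, fun a => ?_, fun a => ⟨?_, hd a⟩⟩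
  · obtain ⟨k, rfl⟩ := Nat.exists_eq_add_of_le' hi
    rw [Nat.add_sub_cancel, comp_eq_time htau, pos_ofTrajectory hp0 t hpe,
      pos_ofTrajectory hp0 t hpe]
    have hk := time_ofTrajectory_le p (fun a => (hmeet a).1) hte he k
    have := hp.dist_le_mul (time (ofTrajectory p t e) (k + 1)) (time (ofTrajectory p t e) k)
    rw [Real.dist_eq, Real.dist_eq, abs_of_nonneg (sub_nonneg.mpr hk)] at this
    simp only [NNReal.coe_one, one_mul] at this
    linarith
  · rw [hrel, zero_add, div_le_iff₀ I.hv, mul_comm]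
    exact (hmeet a).2
  · rw [hrel]
    exact (hmeet a).1

/-- Serving every client at its first meeting time with the server makes a solution
order-preserving without changing the makespan. -/
lemma Feasible.exists_orderPreserving {I : CInstance n} (htau : ∀ a, I.tau a = 0)
    (hrel : ∀ a, I.r a = 0) {sol : CSolution n} (h : Feasible I sol) :
    ∃ sol' : CSolution n, Feasible I sol' ∧ OrderPreserving I sol' ∧
      makespan sol' = makespan sol := by
  obtain ⟨p, hp, hp0, hpe, hpx⟩ := h.exists_trajectory htau
  have hmeet : ∀ a, sol.t a ∈ meetingTimes I.v p (I.s a) := fun a => by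
    refine ⟨h.t_nonneg a, ?_⟩
    have := h.2.1 a
    rwa [hrel, zero_add, div_le_iff₀ I.hv, mul_comm, ← hpx] at this
  choose t ht using fun a => exists_isLeast_meetingTimes hp.continuous ⟨_, hmeet a⟩
  have hle : ∀ a, t a ≤ sol.t a := fun a => (ht a).2 (hmeet a)
  refine ⟨ofTrajectory p t sol.tEnd, ?_, ?_, rfl⟩
  · exact feasible_ofTrajectory htau hrel hp hp0 hpe (fun a => (ht a).1)
      (fun a => (EReal.coe_le_coe_iff.mpr (hle a)).trans (h.2.2 a).2)
      (fun a => (hle a).trans (h.t_le_tEnd htau a)) (h.tEnd_nonneg htau)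
  · intro a a' hside hss
    obtain ⟨τ, hτ, hlt⟩ :=
      exists_lt_mem_meetingTimes I.hv hp.continuous hp0 hside hss (ht a').1
    exact ((ht a).2 hτ).trans_lt hlt

lemma isClosed_feasible (I : CInstance n) (σ : Equiv.Perm (Fin n)) :
    IsClosed {q : (Fin n → ℝ) × (Fin n → ℝ) × ℝ | Feasible I ⟨σ, q.1, q.2.1, q.2.2⟩} := by
  have hpos : ∀ i, Continuous fun q : (Fin n → ℝ) × (Fin n → ℝ) × ℝ =>
      pos ⟨σ, q.1, q.2.1, q.2.2⟩ i := fun i => by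
    unfold pos; split_ifs <;> first | fun_prop | (dsimp only; fun_prop)
  have htime : ∀ i, Continuous fun q : (Fin n → ℝ) × (Fin n → ℝ) × ℝ =>
      time ⟨σ, q.1, q.2.1, q.2.2⟩ i := fun i => by
    unfold time; split_ifs <;> first | fun_prop | (dsimp only; fun_prop)
  have hcomp : ∀ i, Continuous fun q : (Fin n → ℝ) × (Fin n → ℝ) × ℝ =>
      comp I ⟨σ, q.1, q.2.1, q.2.2⟩ i := fun i => by
    unfold comp; split_ifs <;> first | fun_prop | (dsimp only; fun_prop)
  unfold Feasible
  simp only [Set.ofPred_and, Set.ofPred_forall]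
  refine .inter ?_ (.inter ?_ ?_)
  · exact isClosed_iInter fun i => isClosed_iInter fun _ => isClosed_iInter fun _ =>
      isClosed_le ((hcomp _).add ((hpos _).sub (hpos _)).abs) (htime _)
  · exact isClosed_iInter fun a => isClosed_le (by fun_prop) (by fun_prop)
  · exact isClosed_iInter fun a => (isClosed_le (by fun_prop) (by fun_prop)).inter
      (isClosed_le (continuous_coe_real_ereal.comp (by fun_prop)) continuous_const)

lemma exists_optimalTSP {I : CInstance n} (htau : ∀ a, I.tau a = 0)
    (hfeas : ∃ sol : CSolution n, Feasible I sol) : ∃ sol : CSolution n, OptimalTSP I sol := by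
  obtain ⟨sol₀, h₀⟩ := hfeas
  set T := sol₀.tEnd
  let box : Set ((Fin n → ℝ) × (Fin n → ℝ) × ℝ) :=
    Set.Icc (fun _ => 0) (fun _ => T) ×ˢ Set.Icc (fun _ => -T) (fun _ => T) ×ˢ Set.Icc 0 T
  have hbox : IsCompact box := isCompact_Icc.prod (isCompact_Icc.prod isCompact_Icc)
  have mem_box : ∀ sol : CSolution n, Feasible I sol → sol.tEnd ≤ T →
      (sol.t, sol.x, sol.tEnd) ∈ box := fun sol h hT => by
    have ht := fun a => (h.t_le_tEnd htau a).trans hT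
    have hx := fun a => abs_le.mp ((h.abs_x_le htau a).trans (ht a))
    exact ⟨⟨h.t_nonneg, ht⟩, ⟨fun a => (hx a).1, fun a => (hx a).2⟩, h.tEnd_nonneg htau, hT⟩
  let E : Set ℝ := ⋃ σ : Equiv.Perm (Fin n), (fun q => q.2.2) ''
    (box ∩ {q | Feasible I ⟨σ, q.1, q.2.1, q.2.2⟩})
  have mem_E : ∀ sol : CSolution n, Feasible I sol → sol.tEnd ≤ T → sol.tEnd ∈ E :=
    fun sol h hT => Set.mem_iUnion.mpr ⟨sol.σ, _, ⟨mem_box sol h hT, h⟩, rfl⟩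
  have hE : IsCompact E := isCompact_iUnion fun σ =>
    (hbox.inter_right (isClosed_feasible I σ)).image (by fun_prop)
  obtain ⟨e, he, hmin⟩ := hE.exists_isLeast ⟨_, mem_E sol₀ h₀ le_rfl⟩
  obtain ⟨σ, q, ⟨hq, hqf⟩, rfl⟩ := Set.mem_iUnion.mp he
  refine ⟨⟨σ, q.1, q.2.1, q.2.2⟩, hqf, fun sol h => ?_⟩
  rcases le_total sol.tEnd T with hT | hT
  · exact hmin (mem_E sol h hT)
  · exact hq.2.2.2.trans hT

end CLTSP

open CLTSP in
/-- CLTSP with zero processing times and only deadlines: if a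
feasible solution exists, there exists an order-preserving optimal solution. -/
theorem cltsp_zeroProc_deadlines_exists_orderPreserving_optimal
    {n : ℕ} (I : CInstance n)
    (htau : ∀ a, I.tau a = 0) (hrel : ∀ a, I.r a = 0)
    (hfeas : ∃ sol : CSolution n, Feasible I sol) :
    ∃ sol : CSolution n, OptimalTSP I sol ∧ OrderPreserving I sol := by
  obtain ⟨opt, hopt, hmin⟩ := exists_optimalTSP htau hfeas
  obtain ⟨sol, hsol, hord, hspan⟩ := hopt.exists_orderPreserving htau hrel
  exact ⟨sol, ⟨hsol, fun sol' h => hspan.trans_le (hmin sol' h)⟩, hord⟩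
end

section
/- Consider the CLTRP with zero-processing times, only deadlines (τ(a) = 0 and r(a) = 0 for all a ∈ A) and slow clients (0 < v < 1). In every optimal solution (t, x) (one minimizing the sum of completion times C_sum among feasible solutions) the clients are colliding: for each client a with a = σ_i one has t(a) = max{|s(a) − x(a)|/v, c_{i−1}} (each client travels at full speed towards its rendezvous position from time 0 and is served there as early as the server's previous completion permits). -/
open scoped BigOperators

namespace CLTSP

variable {n : ℕ}

/-- The solution `sol` with the rendezvous of client `a` moved to time `t'` and position `x'`. -/
def reschedule (sol : CSolution n) (a : Fin n) (t' x' : ℝ) : CSolution n where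
  σ := sol.σ
  t := Function.update sol.t a t'
  x := Function.update sol.x a x'
  tEnd := sol.tEnd

lemma pos_stop (sol : CSolution n) (a : Fin n) :
    pos sol ((sol.σ.symm a : ℕ) + 1) = sol.x a := by
  simp [pos]

lemma time_stop (sol : CSolution n) (a : Fin n) :
    time sol ((sol.σ.symm a : ℕ) + 1) = sol.t a := by
  simp [time]

lemma comp_stop (I : CInstance n) (sol : CSolution n) (a : Fin n) :
    comp I sol ((sol.σ.symm a : ℕ) + 1) = sol.t a + I.tau a := by
  simp [comp]

lemma stop_ne {sol : CSolution n} {a : Fin n} {i : ℕ} (h : 1 ≤ i ∧ i ≤ n)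
    (hi : i ≠ (sol.σ.symm a : ℕ) + 1) : sol.σ ⟨i - 1, by omega⟩ ≠ a := by
  rintro rfl
  apply hi
  simp
  omega

lemma pos_reschedule (sol : CSolution n) (a : Fin n) (t' x' : ℝ) (i : ℕ) :
    pos (reschedule sol a t' x') i =
      if i = (sol.σ.symm a : ℕ) + 1 then x' else pos sol i := by
  split_ifs with hi
  · subst hi
    simpa [reschedule] using pos_stop (reschedule sol a t' x') a
  · unfold pos
    split_ifs with h
    · exact Function.update_of_ne (stop_ne h hi) _ _
    · rfl

lemma time_reschedule (sol : CSolution n) (a : Fin n) (t' x' : ℝ) (i : ℕ) :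
    time (reschedule sol a t' x') i =
      if i = (sol.σ.symm a : ℕ) + 1 then t' else time sol i := by
  split_ifs with hi
  · subst hi
    simpa [reschedule] using time_stop (reschedule sol a t' x') a
  · unfold time
    split_ifs with h
    · exact Function.update_of_ne (stop_ne h hi) _ _
    · rfl
    · rfl

lemma comp_reschedule (I : CInstance n) (sol : CSolution n) (a : Fin n) (t' x' : ℝ) (i : ℕ) :
    comp I (reschedule sol a t' x') i =
      if i = (sol.σ.symm a : ℕ) + 1 then t' + I.tau a else comp I sol i := by
  split_ifs with hi
  · subst hi
    simpa [reschedule] using comp_stop I (reschedule sol a t' x') a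
  · unfold comp
    split_ifs with h
    · exact congrArg (· + _) (Function.update_of_ne (stop_ne h hi) _ _)
    · rfl
    · rfl

lemma Feasible.server_le {I : CInstance n} {sol : CSolution n} (hf : Feasible I sol)
    (a : Fin n) :
    comp I sol (sol.σ.symm a : ℕ) + |sol.x a - pos sol (sol.σ.symm a : ℕ)| ≤ sol.t a := by
  simpa only [Nat.add_sub_cancel, pos_stop, time_stop] using
    hf.1 ((sol.σ.symm a : ℕ) + 1) (by omega) (by omega)

/-- A rendezvous may be moved to an earlier one that the server and the client both reach in time
and from which the server still reaches the old rendezvous in time. -/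
lemma Feasible.reschedule {I : CInstance n} {sol : CSolution n} (hf : Feasible I sol)
    (a : Fin n) {t' x' : ℝ}
    (hserver : comp I sol (sol.σ.symm a : ℕ) + |x' - pos sol (sol.σ.symm a : ℕ)| ≤ t')
    (hclient : I.r a + |x' - I.s a| / I.v ≤ t')
    (hnext : t' + |sol.x a - x'| ≤ sol.t a) :
    Feasible I (reschedule sol a t' x') := by
  refine ⟨fun i h1 hn => ?_, fun b => ?_, fun b => ?_⟩
  · simp only [pos_reschedule, time_reschedule, comp_reschedule]
    by_cases hi : i = (sol.σ.symm a : ℕ) + 1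
    · subst hi
      simpa using hserver
    · by_cases hj : i - 1 = (sol.σ.symm a : ℕ) + 1
      · have h := hf.1 i h1 hn
        rw [hj, comp_stop, pos_stop] at h
        simp only [hi, hj, if_true, if_false]
        linarith [abs_sub_le (pos sol i) (sol.x a) x']
      · simpa [hi, hj] using hf.1 i h1 hn
  · by_cases hb : b = a
    · subst hb
      simpa [CLTSP.reschedule] using hclient
    · simpa [CLTSP.reschedule, hb] using hf.2.1 b
  · by_cases hb : b = a
    · subst hb
      have hle : t' ≤ sol.t b := by linarith [abs_nonneg (sol.x b - x')]
      have hpos : 0 ≤ |x' - I.s b| / I.v := div_nonneg (abs_nonneg _) I.hv.le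
      simpa [CLTSP.reschedule] using
        And.intro (by linarith : I.r b ≤ t')
          ((EReal.coe_le_coe_iff.mpr hle).trans (hf.2.2 b).2)
    · simpa [CLTSP.reschedule, hb] using hf.2.2 b

lemma csum_reschedule_lt (I : CInstance n) (sol : CSolution n) (a : Fin n) {t' : ℝ} (x' : ℝ)
    (h : t' < sol.t a) : csum I (reschedule sol a t' x') < csum I sol := by
  refine Finset.sum_lt_sum (fun b _ => ?_) ⟨a, Finset.mem_univ a, ?_⟩
  · by_cases hb : b = a
    · subst hb
      simpa [reschedule] using h.le
    · simp [reschedule, hb]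
  · simpa [reschedule] using h

/-- In an optimal solution clients are colliding: otherwise the server could meet a client a little
earlier on its way to the rendezvous. -/
theorem OptimalTRP.colliding {I : CInstance n} {sol : CSolution n} (hopt : OptimalTRP I sol) :
    Colliding I sol := by
  intro a
  have hf := hopt.1
  have hclient := hf.2.1 a
  have hserver := hf.server_le a
  set c := comp I sol (sol.σ.symm a : ℕ)
  set p := pos sol (sol.σ.symm a : ℕ)
  have hD := abs_nonneg (sol.x a - p)
  rw [abs_sub_comm (I.s a)]
  refine le_antisymm (not_lt.mp fun hlt => ?_) (max_le hclient (by linarith))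
  obtain ⟨hgap, hT⟩ := max_lt_iff.mp hlt
  have hv := I.hv
  have hK : 0 < |sol.x a - p| / I.v + (sol.t a - c) := by
    have := div_nonneg hD hv.le
    linarith
  obtain ⟨ε, hε, hε1, hεK⟩ : ∃ ε : ℝ, 0 < ε ∧ ε ≤ 1 ∧
      ε * (|sol.x a - p| / I.v + (sol.t a - c)) ≤
        sol.t a - (I.r a + |sol.x a - I.s a| / I.v) :=
    ⟨min 1 (_ / _), lt_min one_pos (div_pos (sub_pos.mpr hgap) hK), min_le_left _ _,
      (le_div_iff₀ hK).mp (min_le_right _ _)⟩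
  have hshift : |sol.x a - (sol.x a - ε * (sol.x a - p))| = ε * |sol.x a - p| := by
    rw [sub_sub_cancel, abs_mul, abs_of_pos hε]
  have hmul : ε * |sol.x a - p| ≤ ε * (sol.t a - c) :=
    mul_le_mul_of_nonneg_left (by linarith) hε.le
  refine (hopt.2 _ (hf.reschedule a (t' := sol.t a - ε * (sol.t a - c))
    (x' := sol.x a - ε * (sol.x a - p)) ?_ ?_ ?_)).not_gt (csum_reschedule_lt I sol a _ ?_)
  · have : |sol.x a - ε * (sol.x a - p) - p| = (1 - ε) * |sol.x a - p| := by
      rw [show sol.x a - ε * (sol.x a - p) - p = (1 - ε) * (sol.x a - p) by ring, abs_mul,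
        abs_of_nonneg (sub_nonneg.mpr hε1)]
    have := mul_le_mul_of_nonneg_left (by linarith : |sol.x a - p| ≤ sol.t a - c)
      (sub_nonneg.mpr hε1)
    linarith
  · have htri := abs_sub_le (sol.x a - ε * (sol.x a - p)) (sol.x a) (I.s a)
    rw [abs_sub_comm _ (sol.x a), hshift] at htri
    have hdiv := div_le_div_of_nonneg_right htri hv.le
    rw [add_div, mul_div_assoc] at hdiv
    linarith
  · rw [hshift]
    linarith
  · linarith [mul_pos hε (sub_pos.mpr hT)]

end CLTSP

open CLTSP in
/-- CLTRP with zero processing times, only deadlines and slow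
clients: in every optimal solution the clients are colliding. -/
theorem cltrp_zeroProc_deadlines_slow_optimal_colliding
    {n : ℕ} (I : CInstance n)
    (htau : ∀ a, I.tau a = 0) (hrel : ∀ a, I.r a = 0) (hslow : I.v < 1)
    (sol : CSolution n) (hopt : OptimalTRP I sol) :
    Colliding I sol := by
  exact hopt.colliding
end

section
/- Consider the CLTSP with general processing times, only release times (d(a) = ∞ for all a ∈ A) and fast clients (v ≥ 1). Then there exists an optimal solution (one minimizing the makespan among feasible solutions) in which every rendezvous position is at the origin, i.e., x(a) = 0 for all a ∈ A. -/
open scoped BigOperators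

namespace CLTSP

variable {n : ℕ}

/-- Processing time of the `i`-th server stop, which is zero at the start and at the final stop. -/
noncomputable def stopTau (I : CInstance n) (σ : Equiv.Perm (Fin n)) (i : ℕ) : ℝ :=
  if h : 1 ≤ i ∧ i ≤ n then I.tau (σ ⟨i - 1, by omega⟩) else 0

/-- Total processing time from the `i`-th server stop on. -/
noncomputable def remainingTau (I : CInstance n) (σ : Equiv.Perm (Fin n)) (i : ℕ) : ℝ :=
  ∑ j ∈ Finset.Ico i (n + 1), stopTau I σ j

/-- Earliest time at which client `a` can be at the origin. -/
noncomputable def originArrival (I : CInstance n) (a : Fin n) : ℝ := I.r a + |I.s a| / I.v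

/-- Smallest makespan of a solution with serving order `σ` and all rendezvous at the origin. -/
noncomputable def originMakespan (I : CInstance n) (σ : Equiv.Perm (Fin n)) : ℝ :=
  Finset.univ.sup' Finset.univ_nonempty fun k : Option (Fin n) =>
    k.elim (remainingTau I σ 0) fun k => originArrival I (σ k) + remainingTau I σ (k + 1)

/-- The solution with serving order `σ` that serves all clients at the origin, without waiting
after the first rendezvous, and finishes at time `originMakespan I σ`. -/
noncomputable def originSolution (I : CInstance n) (σ : Equiv.Perm (Fin n)) : CSolution n where
  σ := σ
  t a := originMakespan I σ - remainingTau I σ (σ.symm a + 1)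
  x _ := 0
  tEnd := originMakespan I σ

lemma originMakespan_le_iff (I : CInstance n) (σ : Equiv.Perm (Fin n)) (T : ℝ) :
    originMakespan I σ ≤ T ↔ remainingTau I σ 0 ≤ T ∧
      ∀ k : Fin n, originArrival I (σ k) + remainingTau I σ (k + 1) ≤ T := by
  simp [originMakespan, Finset.sup'_le_iff, Option.forall]

lemma remainingTau_eq_add (I : CInstance n) (σ : Equiv.Perm (Fin n)) {i : ℕ} (hi : i ≤ n) :
    remainingTau I σ i = stopTau I σ i + remainingTau I σ (i + 1) :=
  Finset.sum_eq_sum_Ico_succ_bot (Nat.lt_succ_of_le hi) _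

lemma remainingTau_last (I : CInstance n) (σ : Equiv.Perm (Fin n)) :
    remainingTau I σ (n + 1) = 0 := by
  simp [remainingTau]

lemma comp_eq_time_add_stopTau (I : CInstance n) (sol : CSolution n) (i : ℕ) :
    comp I sol i = time sol i + stopTau I sol.σ i := by
  unfold comp time stopTau
  split_ifs <;> simp

lemma time_add_remainingTau_add_abs_pos_le {I : CInstance n} {sol : CSolution n}
    (h : Feasible I sol) {i : ℕ} (hi : i ≤ n + 1) :
    time sol i + remainingTau I sol.σ i + |pos sol i| ≤ sol.tEnd := by
  induction hi using Nat.decreasingInduction with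
  | self => simp [remainingTau_last, time, pos]
  | of_succ i hi ih =>
    have hstep := h.1 (i + 1) (by omega) (by omega)
    rw [Nat.add_sub_cancel, comp_eq_time_add_stopTau] at hstep
    rw [remainingTau_eq_add I sol.σ (by omega)]
    have htri := abs_sub_abs_le_abs_sub (pos sol i) (pos sol (i + 1))
    rw [abs_sub_comm] at htri
    linarith

lemma originMakespan_le_of_feasible {I : CInstance n} (hfast : 1 ≤ I.v) {sol : CSolution n}
    (h : Feasible I sol) : originMakespan I sol.σ ≤ sol.tEnd := by
  refine (originMakespan_le_iff _ _ _).2 ⟨?_, fun k => ?_⟩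
  · simpa [time, pos] using time_add_remainingTau_add_abs_pos_le h (Nat.zero_le _)
  · have hk : (k : ℕ) + 1 ≤ n := k.2
    have hbound := time_add_remainingTau_add_abs_pos_le h (i := k + 1) (by omega)
    simp only [time, pos, le_add_iff_nonneg_left, zero_le, hk, and_self, dite_true,
      Nat.add_sub_cancel, Fin.eta] at hbound
    have hclient := h.2.1 (sol.σ k)
    have hspeed := div_le_self (abs_nonneg (sol.x (sol.σ k))) hfast
    have htri : |I.s (sol.σ k)| / I.v ≤
        |sol.x (sol.σ k)| / I.v + |sol.x (sol.σ k) - I.s (sol.σ k)| / I.v := by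
      rw [← add_div]
      refine div_le_div_of_nonneg_right ?_ I.hv.le
      have := abs_sub_abs_le_abs_sub (I.s (sol.σ k)) (sol.x (sol.σ k))
      rw [abs_sub_comm] at this
      linarith
    unfold originArrival
    linarith

lemma time_originSolution (I : CInstance n) (σ : Equiv.Perm (Fin n)) {i : ℕ} (hi : 1 ≤ i)
    (hi' : i ≤ n + 1) :
    time (originSolution I σ) i = originMakespan I σ - remainingTau I σ i := by
  rcases hi'.lt_or_eq with hlt | rfl
  · have hin : 1 ≤ i ∧ i ≤ n := ⟨hi, by omega⟩
    simp [time, originSolution, hin, Nat.sub_add_cancel hi]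
  · simp [time, originSolution, remainingTau_last]

lemma feasible_originSolution (I : CInstance n) (hdead : ∀ a, I.d a = ⊤)
    (σ : Equiv.Perm (Fin n)) : Feasible I (originSolution I σ) := by
  obtain ⟨htotal, hclients⟩ := (originMakespan_le_iff I σ _).1 le_rfl
  have harrive (a : Fin n) : I.r a + |I.s a| / I.v ≤ (originSolution I σ).t a := by
    have := hclients (σ.symm a)
    simp only [originArrival, Equiv.apply_symm_apply] at this
    simp only [originSolution]
    linarith
  refine ⟨fun i hi hi' => ?_, fun a => by simpa [originSolution] using harrive a,
    fun a => ⟨?_, by simp [hdead]⟩⟩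
  · obtain ⟨i, rfl⟩ := Nat.exists_eq_add_of_le' hi
    have hpos (j : ℕ) : pos (originSolution I σ) j = 0 := by simp [pos, originSolution]
    have htime : time (originSolution I σ) i ≤ originMakespan I σ - remainingTau I σ i := by
      rcases Nat.eq_zero_or_pos i with rfl | hi0
      · simpa [time] using htotal
      · exact (time_originSolution I σ hi0 (by omega)).le
    rw [time_originSolution I σ hi hi', Nat.add_sub_cancel, comp_eq_time_add_stopTau, hpos, hpos]
    have hrem := remainingTau_eq_add I σ (i := i) (by omega)
    change _ + stopTau I σ i + _ ≤ _
    simp only [sub_self, abs_zero]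
    linarith
  · have := harrive a
    have := div_nonneg (abs_nonneg (I.s a)) I.hv.le
    linarith

end CLTSP

open CLTSP in
/-- CLTSP with general processing times, only release times and
fast clients: there exists an optimal solution in which every rendezvous takes
place at the origin. -/
theorem cltsp_genProc_release_fast_exists_origin_optimal
    {n : ℕ} (I : CInstance n)
    (hdead : ∀ a, I.d a = ⊤) (hfast : 1 ≤ I.v) :
    ∃ sol : CSolution n, OptimalTSP I sol ∧ ∀ a : Fin n, sol.x a = 0 := by
  obtain ⟨σ, hσ⟩ := Finite.exists_min (originMakespan I)
  exact ⟨originSolution I σ, ⟨feasible_originSolution I hdead σ, fun sol' h' =>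
    (hσ sol'.σ).trans (originMakespan_le_of_feasible hfast h')⟩, fun _ => rfl⟩
end
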